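/- Infeasibility certificate (Lemma 2(i)): under Assumptions Φ(i) and Φ(ii), if δ*(θ;γ,P) > δ, then there exists no probability measure F ∈ N_δ under which the model constraints hold at (θ,γ,P); equivalently, κ̲_δ(θ;γ,P) = +∞ and κ̄_δ(θ;γ,P) = −∞. -/

import Mathlib

open MeasureTheory Filter Set
open scoped ENNReal Pointwise Classical

noncomputable section

namespace CFSens

/-- map an extended real to `ℝ≥0∞` (negatives go to `0`; only used on nonnegative values). -/
def erealToENNReal (x : EReal) : ℝ≥0∞ := if x = ⊤ then ⊤ else ENNReal.ofReal x.toReal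

/-- Euclidean dot product. -/
def dot {ι : Type*} [Fintype ι] (a b : ι → ℝ) : ℝ := ∑ i, a i * b i

/-- Convex conjugate `φ*(x) = sup_{t ≥ 0} (t x - φ t)` (`EReal`-valued). -/
def phiStar (φ : ℝ → ℝ) (x : ℝ) : EReal :=
  ⨆ t ∈ Set.Ici (0:ℝ), ((t * x - φ t : ℝ) : EReal)

/-- Convex conjugate `(ηφ)*(x) = sup_{t ≥ 0} (t x - η φ t)` of `ηφ`, for `η ≥ 0`. -/
def etaPhiStar (φ : ℝ → ℝ) (η x : ℝ) : EReal :=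
  ⨆ t ∈ Set.Ici (0:ℝ), ((t * x - η * φ t : ℝ) : EReal)

/-- `ψ(x) = φ*(x) - x`. -/
def psi (φ : ℝ → ℝ) (x : ℝ) : EReal := phiStar φ x - (x : EReal)

/-- Assumption Φ(i).  Here `φ : ℝ → ℝ` records the (finite) values of the divergence cost
on `[0,∞)`; the paper's extension `φ(x) = +∞` for `x < 0` is encoded separately wherever it
matters (nonnegativity of densities), and `φ(0) < ∞` is automatic since `φ` is real-valued. -/
structure PhiOne (φ : ℝ → ℝ) : Prop where
  smooth : ContDiffOn ℝ 2 φ (Set.Ioi (0:ℝ))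
  sconvex : StrictConvexOn ℝ (Set.Ici (0:ℝ)) φ
  one : φ 1 = 0
  done : deriv φ 1 = 0
  superlinear : Tendsto (fun x => φ x / x) atTop atTop
  dzero : ∃ L : EReal, L < 0 ∧
    Tendsto (fun x => ((deriv φ x : ℝ) : EReal)) (nhdsWithin 0 (Set.Ioi 0)) (nhds L)
  dinfty : ∃ L : EReal, 0 < L ∧ Tendsto (fun x => ((deriv φ x : ℝ) : EReal)) atTop (nhds L)
  delta2 : ∃ L : ℝ, Tendsto (fun x => x * deriv φ x / φ x) atTop (nhds L)

variable {U : Type*} [MeasurableSpace U] {dθ d1 d2 d3 d4 : ℕ} {Γ : Type*}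

/-- Stacked moment values/multipliers `(v1,v2,v3,v4)`. -/
abbrev Vec4 (d1 d2 d3 d4 : ℕ) :=
  (Fin d1 → ℝ) × (Fin d2 → ℝ) × (Fin d3 → ℝ) × (Fin d4 → ℝ)

/-- The targeted moments `P = (P1,P2)`. -/
abbrev Vec12 (d1 d2 : ℕ) := (Fin d1 → ℝ) × (Fin d2 → ℝ)

/-- `λ'g` for stacked vectors. -/
def dot4 (a b : Vec4 d1 d2 d3 d4) : ℝ :=
  dot a.1 b.1 + dot a.2.1 b.2.1 + dot a.2.2.1 b.2.2.1 + dot a.2.2.2 b.2.2.2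

/-- dot product on `Vec12`. -/
def dot12 (a b : Vec12 d1 d2) : ℝ := dot a.1 b.1 + dot a.2 b.2

/-- `λ ∈ Λ`, i.e. the multipliers on the inequality constraints are nonnegative. -/
def inLambda (l : Vec4 d1 d2 d3 d4) : Prop := (∀ i, 0 ≤ l.1 i) ∧ (∀ i, 0 ≤ l.2.2.1 i)

/-- `λ12'P`. -/
def dotP (l : Vec4 d1 d2 d3 d4) (P : Vec12 d1 d2) : ℝ := dot l.1 P.1 + dot l.2.1 P.2

/-- The φ-divergence `D_φ(F‖F*)` (`= +∞` unless `F ≪ F*`). -/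
def Dphi (φ : ℝ → ℝ) (Fstar F : Measure U) : ℝ≥0∞ :=
  if F ≪ Fstar then ∫⁻ u, ENNReal.ofReal (φ (F.rnDeriv Fstar u).toReal) ∂Fstar else ⊤

/-- Membership in the Orlicz heart `ℰ`: `∫ ψ(c|f|) dF* < ∞` for all `c > 0`. -/
def MemE (φ : ℝ → ℝ) (Fstar : Measure U) (f : U → ℝ) : Prop :=
  Measurable f ∧ ∀ c : ℝ, 0 < c → ∫⁻ u, erealToENNReal (psi φ (c * |f u|)) ∂Fstar < ⊤

/-- The Orlicz norm `‖f‖_ψ = inf_{c>0} c⁻¹ (1 + ∫ ψ(c|f|) dF*)`. -/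
def psiNorm (φ : ℝ → ℝ) (Fstar : Measure U) (f : U → ℝ) : ℝ≥0∞ :=
  ⨅ c ∈ Set.Ioi (0:ℝ),
    (ENNReal.ofReal c)⁻¹ * (1 + ∫⁻ u, erealToENNReal (psi φ (c * |f u|)) ∂Fstar)

/-- `E^{F*}[f]` for an `EReal`-valued integrand bounded below by `-c`. -/
def eExp (Fstar : Measure U) (c : ℝ) (f : U → EReal) : EReal :=
  ((∫⁻ u, erealToENNReal (f u + (c : EReal)) ∂Fstar : ℝ≥0∞) : EReal) - (c : EReal)

/-- Sequential lower hemicontinuity of a correspondence `A` (sequences taken in `S`). -/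
def LowerHemicontinuousAt {α β : Type*} [TopologicalSpace α] [TopologicalSpace β]
    (A : α → Set β) (S : Set α) (x : α) : Prop :=
  ∀ xs : ℕ → α, (∀ n, xs n ∈ S) → Tendsto xs atTop (nhds x) →
    ∀ y ∈ A x, ∃ ys : ℕ → β, (∀ n, ys n ∈ A (xs n)) ∧ Tendsto ys atTop (nhds y)

section Model

variable (φ : ℝ → ℝ) (Fstar : Measure U)
variable (g : U → (Fin dθ → ℝ) → Γ → Vec4 d1 d2 d3 d4)
variable (k : U → (Fin dθ → ℝ) → Γ → ℝ)

/-- All components of `g(·,θ,γ)` are integrable under `F`. -/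
def GIntegrable (θ : Fin dθ → ℝ) (γ : Γ) (F : Measure U) : Prop :=
  (∀ i, Integrable (fun u => (g u θ γ).1 i) F) ∧
  (∀ i, Integrable (fun u => (g u θ γ).2.1 i) F) ∧
  (∀ i, Integrable (fun u => (g u θ γ).2.2.1 i) F) ∧
  (∀ i, Integrable (fun u => (g u θ γ).2.2.2 i) F)

/-- The model constraints (1)–(4): `E^F[g1] ≤ P1`, `E^F[g2] = P2`, `E^F[g3] ≤ 0`, `E^F[g4] = 0`. -/
def ConstraintsHold (θ : Fin dθ → ℝ) (γ : Γ) (P : Vec12 d1 d2) (F : Measure U) : Prop :=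
  GIntegrable g θ γ F ∧
  (∀ i, ∫ u, (g u θ γ).1 i ∂F ≤ P.1 i) ∧
  (∀ i, ∫ u, (g u θ γ).2.1 i ∂F = P.2 i) ∧
  (∀ i, ∫ u, (g u θ γ).2.2.1 i ∂F ≤ 0) ∧
  (∀ i, ∫ u, (g u θ γ).2.2.2 i ∂F = 0)

/-- `F ∈ N_δ` and the model constraints hold at `(θ,γ,P)` under `F`. -/
def Feasible (δ : ℝ) (θ : Fin dθ → ℝ) (γ : Γ) (P : Vec12 d1 d2) (F : Measure U) : Prop :=
  IsProbabilityMeasure F ∧ Dphi φ Fstar F ≤ ENNReal.ofReal δ ∧ ConstraintsHold g θ γ P F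

/-- `κ̲_δ(θ;γ,P)`: primal lower value (explicit-dependence case); `= ⊤` if infeasible. -/
def kappaLow (δ : ℝ) (θ : Fin dθ → ℝ) (γ : Γ) (P : Vec12 d1 d2) : EReal :=
  sInf {x : EReal | ∃ F : Measure U, Feasible φ Fstar g δ θ γ P F ∧
    Integrable (fun u => k u θ γ) F ∧ x = ((∫ u, k u θ γ ∂F : ℝ) : EReal)}

/-- `κ̄_δ(θ;γ,P)`: primal upper value (explicit-dependence case); `= ⊥` if infeasible. -/
def kappaHigh (δ : ℝ) (θ : Fin dθ → ℝ) (γ : Γ) (P : Vec12 d1 d2) : EReal :=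
  sSup {x : EReal | ∃ F : Measure U, Feasible φ Fstar g δ θ γ P F ∧
    Integrable (fun u => k u θ γ) F ∧ x = ((∫ u, k u θ γ ∂F : ℝ) : EReal)}

/-- `κ̲*_δ(θ;γ,P)`: the dual program of `κ̲_δ`.  Multipliers with
`E^{F*}[(ηφ)*(...)] = +∞` contribute `-∞` to the supremum and are omitted from the
index set; `w` is a real-valued integrable version of the conjugate integrand. -/
def kappaLowDual (δ : ℝ) (θ : Fin dθ → ℝ) (γ : Γ) (P : Vec12 d1 d2) : EReal :=
  sSup {x : EReal | ∃ η : ℝ, 0 ≤ η ∧ ∃ ζ : ℝ, ∃ l : Vec4 d1 d2 d3 d4, inLambda l ∧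
    ∃ w : U → ℝ, Integrable w Fstar ∧
      (∀ᵐ u ∂Fstar, (w u : EReal) = etaPhiStar φ η (-(k u θ γ) - ζ - dot4 l (g u θ γ))) ∧
      x = ((-(∫ u, w u ∂Fstar) - η * δ - ζ - dotP l P : ℝ) : EReal)}

/-- `κ̄*_δ(θ;γ,P)`: the dual program of `κ̄_δ`. -/
def kappaHighDual (δ : ℝ) (θ : Fin dθ → ℝ) (γ : Γ) (P : Vec12 d1 d2) : EReal :=
  sInf {x : EReal | ∃ η : ℝ, 0 ≤ η ∧ ∃ ζ : ℝ, ∃ l : Vec4 d1 d2 d3 d4, inLambda l ∧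
    ∃ w : U → ℝ, Integrable w Fstar ∧
      (∀ᵐ u ∂Fstar, (w u : EReal) = etaPhiStar φ η (k u θ γ - ζ - dot4 l (g u θ γ))) ∧
      x = (((∫ u, w u ∂Fstar) + η * δ + ζ + dotP l P : ℝ) : EReal)}

/-- `δ*(θ;γ,P) = sup_{ζ,λ∈Λ} ( -E^{F*}[φ*(-ζ-λ'g)] - ζ - λ12'P )`. -/
def deltaStar (θ : Fin dθ → ℝ) (γ : Γ) (P : Vec12 d1 d2) : EReal :=
  sSup {x : EReal | ∃ ζ : ℝ, ∃ l : Vec4 d1 d2 d3 d4, inLambda l ∧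
    ∃ w : U → ℝ, Integrable w Fstar ∧
      (∀ᵐ u ∂Fstar, (w u : EReal) = phiStar φ (-ζ - dot4 l (g u θ γ))) ∧
      x = ((-(∫ u, w u ∂Fstar) - ζ - dotP l P : ℝ) : EReal)}

/-- `{E^F[g(U,θ,γ)] : F ∈ N_∞}`. -/
def momentSet (θ : Fin dθ → ℝ) (γ : Γ) : Set (Vec4 d1 d2 d3 d4) :=
  {v | ∃ F : Measure U, IsProbabilityMeasure F ∧ Dphi φ Fstar F < ⊤ ∧ GIntegrable g θ γ F ∧
    v = ((fun i => ∫ u, (g u θ γ).1 i ∂F), (fun i => ∫ u, (g u θ γ).2.1 i ∂F),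
         (fun i => ∫ u, (g u θ γ).2.2.1 i ∂F), (fun i => ∫ u, (g u θ γ).2.2.2 i ∂F))}

/-- The cone `𝒞 = ℝ^{d1}_{≥0} × {0} × ℝ^{d3}_{≥0} × {0}`. -/
def coneC : Set (Vec4 d1 d2 d3 d4) :=
  {c | (∀ i, 0 ≤ c.1 i) ∧ c.2.1 = 0 ∧ (∀ i, 0 ≤ c.2.2.1 i) ∧ c.2.2.2 = 0}

/-- Condition S at `(θ,γ,P)`. -/
def ConditionS (θ : Fin dθ → ℝ) (γ : Γ) (P : Vec12 d1 d2) : Prop :=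
  ((P.1, P.2, (0 : Fin d3 → ℝ), (0 : Fin d4 → ℝ)) : Vec4 d1 d2 d3 d4) ∈
    interior (momentSet φ Fstar g θ γ + coneC)

/-- Assumption Φ(ii): `k(·,θ,γ)` and each component of `g(·,θ,γ)` lie in `ℰ`. -/
def PhiTwo : Prop :=
  ∀ (θ : Fin dθ → ℝ) (γ : Γ), MemE φ Fstar (fun u => k u θ γ) ∧
    (∀ i, MemE φ Fstar (fun u => (g u θ γ).1 i)) ∧
    (∀ i, MemE φ Fstar (fun u => (g u θ γ).2.1 i)) ∧
    (∀ i, MemE φ Fstar (fun u => (g u θ γ).2.2.1 i)) ∧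
    (∀ i, MemE φ Fstar (fun u => (g u θ γ).2.2.2 i))

/-- `Θ_δ = {θ ∈ Θ : δ*(θ;γ0,P0) < δ}`. -/
def ThetaDelta (Θ : Set (Fin dθ → ℝ)) (γ0 : Γ) (P0 : Vec12 d1 d2) (δ : ℝ) :
    Set (Fin dθ → ℝ) :=
  {θ ∈ Θ | deltaStar φ Fstar g θ γ0 P0 < ((δ : ℝ) : EReal)}

/-- Implicit-dependence lower value: `kI(θ,γ)` if feasible, `+∞` otherwise. -/
def kappaLowImp (kI : (Fin dθ → ℝ) → Γ → ℝ) (δ : ℝ) (θ : Fin dθ → ℝ) (γ : Γ)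
    (P : Vec12 d1 d2) : EReal :=
  sInf {x : EReal | ∃ F : Measure U, Feasible φ Fstar g δ θ γ P F ∧ x = ((kI θ γ : ℝ) : EReal)}

/-- Implicit-dependence upper value: `kI(θ,γ)` if feasible, `-∞` otherwise. -/
def kappaHighImp (kI : (Fin dθ → ℝ) → Γ → ℝ) (δ : ℝ) (θ : Fin dθ → ℝ) (γ : Γ)
    (P : Vec12 d1 d2) : EReal :=
  sSup {x : EReal | ∃ F : Measure U, Feasible φ Fstar g δ θ γ P F ∧ x = ((kI θ γ : ℝ) : EReal)}

/-- The criterion `K̲_δ(θ;γ,P)`. -/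
def KLowCrit (δ : ℝ) (θ : Fin dθ → ℝ) (γ : Γ) (P : Vec12 d1 d2) : EReal :=
  if deltaStar φ Fstar g θ γ P < ((δ : ℝ) : EReal) then kappaLowDual φ Fstar g k δ θ γ P
  else if deltaStar φ Fstar g θ γ P = ((δ : ℝ) : EReal) then kappaLow φ Fstar g k δ θ γ P
  else ⊤

/-- The criterion `K̄_δ(θ;γ,P)`. -/
def KHighCrit (δ : ℝ) (θ : Fin dθ → ℝ) (γ : Γ) (P : Vec12 d1 d2) : EReal :=
  if deltaStar φ Fstar g θ γ P < ((δ : ℝ) : EReal) then kappaHighDual φ Fstar g k δ θ γ P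
  else if deltaStar φ Fstar g θ γ P = ((δ : ℝ) : EReal) then kappaHigh φ Fstar g k δ θ γ P
  else ⊥

/-- ℰ-continuity of a family `f(·,θ,γ)` in `(θ,γ)` on `Θ × Γ`. -/
def EContinuousIn [TopologicalSpace Γ] (Θ : Set (Fin dθ → ℝ))
    (f : U → (Fin dθ → ℝ) → Γ → ℝ) : Prop :=
  ∀ θ0 ∈ Θ, ∀ γ0 : Γ,
    Tendsto (fun p : (Fin dθ → ℝ) × Γ => psiNorm φ Fstar (fun u => f u p.1 p.2 - f u θ0 γ0))
      (nhdsWithin (θ0, γ0) (Θ ×ˢ (Set.univ : Set Γ))) (nhds 0)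

/-- Assumption M(i) for the moment functions. -/
def MOneG [TopologicalSpace Γ] (Θ : Set (Fin dθ → ℝ)) : Prop :=
  (∀ i, EContinuousIn φ Fstar Θ (fun u θ γ => (g u θ γ).1 i)) ∧
  (∀ i, EContinuousIn φ Fstar Θ (fun u θ γ => (g u θ γ).2.1 i)) ∧
  (∀ i, EContinuousIn φ Fstar Θ (fun u θ γ => (g u θ γ).2.2.1 i)) ∧
  (∀ i, EContinuousIn φ Fstar Θ (fun u θ γ => (g u θ γ).2.2.2 i))

/-- Assumption M(v). -/
def MFive [TopologicalSpace Γ] (Θ : Set (Fin dθ → ℝ)) : Prop :=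
  ∀ (c1 c2 : ℝ) (c3 : Vec4 d1 d2 d3 d4), ContinuousOn
    (fun p : (Fin dθ → ℝ) × Γ =>
      eExp Fstar (φ 0) (fun u => phiStar φ (c1 + c2 * k u p.1 p.2 + dot4 c3 (g u p.1 p.2))))
    (Θ ×ˢ (Set.univ : Set Γ))

/-- Objective of the dual program for the lower value, as a function of `(η,ζ,λ)`. -/
def lowObj (δ : ℝ) (θ : Fin dθ → ℝ) (γ : Γ) (P : Vec12 d1 d2) (η ζ : ℝ)
    (l : Vec4 d1 d2 d3 d4) : EReal :=
  -(eExp Fstar (η * φ 0) (fun u => etaPhiStar φ η (-(k u θ γ) - ζ - dot4 l (g u θ γ))))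
    - ((η * δ : ℝ) : EReal) - ((ζ : ℝ) : EReal) - ((dotP l P : ℝ) : EReal)

/-- Objective of the dual program for the upper value. -/
def highObj (δ : ℝ) (θ : Fin dθ → ℝ) (γ : Γ) (P : Vec12 d1 d2) (η ζ : ℝ)
    (l : Vec4 d1 d2 d3 d4) : EReal :=
  (eExp Fstar (η * φ 0) (fun u => etaPhiStar φ η (k u θ γ - ζ - dot4 l (g u θ γ))))
    + ((η * δ : ℝ) : EReal) + ((ζ : ℝ) : EReal) + ((dotP l P : ℝ) : EReal)

/-- `Ξ̲_δ(θ)`: maximizers of the lower dual program. -/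
def XiLow (δ : ℝ) (θ : Fin dθ → ℝ) (γ : Γ) (P : Vec12 d1 d2) :
    Set (ℝ × ℝ × Vec4 d1 d2 d3 d4) :=
  {ξ | 0 ≤ ξ.1 ∧ inLambda ξ.2.2 ∧ ∀ ξ' : ℝ × ℝ × Vec4 d1 d2 d3 d4, 0 ≤ ξ'.1 → inLambda ξ'.2.2 →
    lowObj φ Fstar g k δ θ γ P ξ'.1 ξ'.2.1 ξ'.2.2 ≤ lowObj φ Fstar g k δ θ γ P ξ.1 ξ.2.1 ξ.2.2}

/-- `Ξ̄_δ(θ)`: minimizers of the upper dual program. -/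
def XiHigh (δ : ℝ) (θ : Fin dθ → ℝ) (γ : Γ) (P : Vec12 d1 d2) :
    Set (ℝ × ℝ × Vec4 d1 d2 d3 d4) :=
  {ξ | 0 ≤ ξ.1 ∧ inLambda ξ.2.2 ∧ ∀ ξ' : ℝ × ℝ × Vec4 d1 d2 d3 d4, 0 ≤ ξ'.1 → inLambda ξ'.2.2 →
    highObj φ Fstar g k δ θ γ P ξ.1 ξ.2.1 ξ.2.2 ≤ highObj φ Fstar g k δ θ γ P ξ'.1 ξ'.2.1 ξ'.2.2}

/-- `Λ̲_δ(θ)`: `(λ1,λ2)`-projections of `Ξ̲_δ(θ)`. -/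
def LamLow (δ : ℝ) (θ : Fin dθ → ℝ) (γ : Γ) (P : Vec12 d1 d2) : Set (Vec12 d1 d2) :=
  {p | ∃ ξ ∈ XiLow φ Fstar g k δ θ γ P, ξ.2.2.1 = p.1 ∧ ξ.2.2.2.1 = p.2}

/-- `Λ̄_δ(θ)`: `(λ1,λ2)`-projections of `Ξ̄_δ(θ)`. -/
def LamHigh (δ : ℝ) (θ : Fin dθ → ℝ) (γ : Γ) (P : Vec12 d1 d2) : Set (Vec12 d1 d2) :=
  {p | ∃ ξ ∈ XiHigh φ Fstar g k δ θ γ P, ξ.2.2.1 = p.1 ∧ ξ.2.2.2.1 = p.2}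

end Model

end CFSens

open CFSens

/-- A real integral is bounded by any nonnegative bound on the integral of the positive part. -/
theorem integral_le_of_lintegral_ofReal_le {U : Type*} [MeasurableSpace U] {μ : Measure U}
    {h : U → ℝ} (hh : Integrable h μ) {δ : ℝ} (hδ : 0 ≤ δ)
    (hle : ∫⁻ u, ENNReal.ofReal (h u) ∂μ ≤ ENNReal.ofReal δ) : ∫ u, h u ∂μ ≤ δ := by
  rw [integral_eq_lintegral_pos_part_sub_lintegral_neg_part hh]
  have h1 := ENNReal.toReal_mono ENNReal.ofReal_ne_top hle
  rw [ENNReal.toReal_ofReal hδ] at h1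
  exact (sub_le_self _ ENNReal.toReal_nonneg).trans h1

/-- The Fenchel–Young inequality for `φ` and `phiStar φ`. -/
theorem mul_sub_le_of_eq_phiStar {φ : ℝ → ℝ} {x y t : ℝ} (hy : (y : EReal) = phiStar φ x)
    (ht : 0 ≤ t) : t * x - y ≤ φ t := by
  have h : ((t * x - φ t : ℝ) : EReal) ≤ (y : EReal) := by
    rw [hy]
    exact le_iSup₂ (f := fun t (_ : t ∈ Set.Ici (0:ℝ)) => ((t * x - φ t : ℝ) : EReal)) t ht
  linarith [EReal.coe_le_coe_iff.mp h]

/-- Weak duality between the `φ`-divergence and its conjugate. -/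
theorem integral_sub_le_of_Dphi_le {U : Type*} [MeasurableSpace U] {φ : ℝ → ℝ}
    {Fstar F : Measure U} [IsProbabilityMeasure Fstar] [IsProbabilityMeasure F] {δ : ℝ}
    (hδ : 0 ≤ δ) (hD : Dphi φ Fstar F ≤ ENNReal.ofReal δ) {x w : U → ℝ} (hx : Integrable x F)
    (hw : Integrable w Fstar) (hwx : ∀ᵐ u ∂Fstar, (w u : EReal) = phiStar φ (x u)) :
    ∫ u, x u ∂F - ∫ u, w u ∂Fstar ≤ δ := by
  have hac : F ≪ Fstar := by
    by_contra hac
    simp [Dphi, hac] at hD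
  rw [Dphi, if_pos hac] at hD
  have hfx : Integrable (fun u => (F.rnDeriv Fstar u).toReal • x u) Fstar :=
    (integrable_rnDeriv_smul_iff hac).2 hx
  rw [← integral_rnDeriv_smul hac, ← integral_sub hfx hw]
  refine integral_le_of_lintegral_ofReal_le (hfx.sub hw) hδ (le_trans (lintegral_mono_ae ?_) hD)
  filter_upwards [hwx] with u hu
  exact ENNReal.ofReal_le_ofReal (mul_sub_le_of_eq_phiStar hu ENNReal.toReal_nonneg)

theorem integrable_dot {U ι : Type*} [MeasurableSpace U] [Fintype ι] {F : Measure U}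
    {f : U → ι → ℝ} (hf : ∀ i, Integrable (fun u => f u i) F) (a : ι → ℝ) :
    Integrable (fun u => dot a (f u)) F :=
  integrable_finsetSum _ fun i _ => (hf i).const_mul (a i)

theorem integral_dot {U ι : Type*} [MeasurableSpace U] [Fintype ι] {F : Measure U}
    {f : U → ι → ℝ} (hf : ∀ i, Integrable (fun u => f u i) F) (a : ι → ℝ) :
    ∫ u, dot a (f u) ∂F = dot a (fun i => ∫ u, f u i ∂F) := by
  unfold dot
  rw [integral_finsetSum _ fun i _ => (hf i).const_mul (a i)]
  simp only [integral_const_mul]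

theorem dot_le_dot {ι : Type*} [Fintype ι] {a b c : ι → ℝ} (ha : ∀ i, 0 ≤ a i)
    (hbc : ∀ i, b i ≤ c i) : dot a b ≤ dot a c :=
  Finset.sum_le_sum fun i _ => mul_le_mul_of_nonneg_left (hbc i) (ha i)

/-- Under the model constraints, the expectation of `dot4 l g` is at most `dotP l P` for every
admissible multiplier `l`. -/
theorem CFSens.ConstraintsHold.integral_dot4_le {U : Type*} [MeasurableSpace U] {dθ d1 d2 d3 d4 : ℕ}
    {Γ : Type*} {g : U → (Fin dθ → ℝ) → Γ → Vec4 d1 d2 d3 d4} {θ : Fin dθ → ℝ} {γ : Γ}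
    {P : Vec12 d1 d2} {F : Measure U} (h : ConstraintsHold g θ γ P F)
    {l : Vec4 d1 d2 d3 d4} (hl : inLambda l) :
    Integrable (fun u => dot4 l (g u θ γ)) F ∧ ∫ u, dot4 l (g u θ γ) ∂F ≤ dotP l P := by
  obtain ⟨⟨i1, i2, i3, i4⟩, h1, h2, h3, h4⟩ := h
  have j1 := integrable_dot i1 l.1
  have j2 := integrable_dot i2 l.2.1
  have j3 := integrable_dot i3 l.2.2.1
  have j4 := integrable_dot i4 l.2.2.2
  have j12 := j1.fun_add j2
  have j123 := j12.fun_add j3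
  refine ⟨j123.fun_add j4, ?_⟩
  have e : ∫ u, dot4 l (g u θ γ) ∂F = ∫ u, dot l.1 (g u θ γ).1 ∂F
      + ∫ u, dot l.2.1 (g u θ γ).2.1 ∂F + ∫ u, dot l.2.2.1 (g u θ γ).2.2.1 ∂F
      + ∫ u, dot l.2.2.2 (g u θ γ).2.2.2 ∂F := by
    unfold dot4
    rw [integral_add j123 j4, integral_add j12 j3, integral_add j1 j2]
  rw [e, integral_dot i1, integral_dot i2, integral_dot i3, integral_dot i4, funext h2,
    funext h4]
  have k1 := dot_le_dot hl.1 h1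
  have k3 := dot_le_dot hl.2 h3
  have z3 : dot l.2.2.1 (fun _ => 0) = 0 := by simp [dot]
  have z4 : dot l.2.2.2 (fun _ => 0) = 0 := by simp [dot]
  rw [z3] at k3
  rw [z4, dotP]
  linarith

/-- If some `F ∈ N_δ` satisfies the model constraints, then `δ* ≤ δ`. -/
theorem CFSens.Feasible.deltaStar_le {U : Type*} [MeasurableSpace U] {dθ d1 d2 d3 d4 : ℕ} {Γ : Type*}
    {φ : ℝ → ℝ} {Fstar : Measure U} [IsProbabilityMeasure Fstar]
    {g : U → (Fin dθ → ℝ) → Γ → Vec4 d1 d2 d3 d4} {δ : ℝ} (hδ : 0 ≤ δ) {θ : Fin dθ → ℝ} {γ : Γ}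
    {P : Vec12 d1 d2} {F : Measure U} (hF : Feasible φ Fstar g δ θ γ P F) :
    deltaStar φ Fstar g θ γ P ≤ ((δ : ℝ) : EReal) := by
  obtain ⟨hprob, hD, hC⟩ := hF
  refine sSup_le ?_
  rintro _ ⟨ζ, l, hl, w, hw, hwe, rfl⟩
  obtain ⟨hint, hle⟩ := hC.integral_dot4_le hl
  have hζ : Integrable (fun _ : U => -ζ) F := integrable_const _
  have key := integral_sub_le_of_Dphi_le hδ hD (hζ.sub hint) hw hwe
  simp only [Pi.sub_apply] at key
  rw [integral_sub hζ hint] at key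
  simp only [integral_const, probReal_univ, one_smul] at key
  exact EReal.coe_le_coe_iff.mpr (by linarith)

/-- **Infeasibility certificate; Lemma 2(i).**
Under Assumptions Φ(i) and Φ(ii), if `δ*(θ;γ,P) > δ` then there exists no probability
measure `F ∈ N_δ` under which the model constraints hold at `(θ,γ,P)`;
equivalently `κ̲_δ(θ;γ,P) = +∞` and `κ̄_δ(θ;γ,P) = -∞`. -/
theorem infeasibility_certificate
    {U : Type*} [MeasurableSpace U] {dθ d1 d2 d3 d4 : ℕ} {Γ : Type*}
    (φ : ℝ → ℝ) (Fstar : Measure U) [IsProbabilityMeasure Fstar]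
    (g : U → (Fin dθ → ℝ) → Γ → Vec4 d1 d2 d3 d4)
    (k : U → (Fin dθ → ℝ) → Γ → ℝ)
    (Θ : Set (Fin dθ → ℝ))
    (hΦ1 : PhiOne φ)
    (hΦ2 : PhiTwo φ Fstar g k)
    (δ : ℝ) (hδ : 0 < δ)
    (θ : Fin dθ → ℝ) (hθ : θ ∈ Θ) (γ : Γ) (P : Vec12 d1 d2)
    (hδs : ((δ : ℝ) : EReal) < deltaStar φ Fstar g θ γ P) :
    (¬ ∃ F : Measure U, Feasible φ Fstar g δ θ γ P F) ∧
    kappaLow φ Fstar g k δ θ γ P = ⊤ ∧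
    kappaHigh φ Fstar g k δ θ γ P = ⊥ := by
  have hno : ∀ F : Measure U, ¬ Feasible φ Fstar g δ θ γ P F :=
    fun F hF => hδs.not_ge (hF.deltaStar_le hδ.le)
  refine ⟨not_exists.2 hno, ?_, ?_⟩
  · simp [kappaLow, hno]
  · simp [kappaHigh, hno]
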